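/- arXiv:1412.6777 — 2 statements merged into one kernel-verified Lean document; each statement's English description precedes it below -/
import Mathlib

section
/- Second y-derivative of the real part of the phase function: Fix an integer M ≥ 1 and a real a > 0. For all real x and all real y ≠ 0, the second partial derivative of Re F̂(x + iy; a) with respect to y equals [ (M + 1 − M·x)·x·(x−1) − (M·x + 1)·y² ] / [ (x² + y²)·((x−1)² + y²) ]. In particular this quantity is independent of a. -/
open Complex Real Set Filter

/-- The phase function `F̂(z; a)` (principal branch of `log`). -/
noncomputable def Fhat (M : ℕ) (z : ℂ) (a : ℝ) : ℂ :=
  ((M : ℂ) + 1) * z * (Complex.log z - 1) - (z - 1) * (Complex.log (z - 1) - 1) -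
    z * (Real.log a : ℂ)

/-- The parametrization `ζ(φ)` of the steepest ascent curve. -/
noncomputable def zeta (M : ℕ) (φ : ℝ) : ℂ :=
  ((Real.sin ((M + 1) * φ) / Real.sin (M * φ) : ℝ) : ℂ) * Complex.exp ((φ : ℂ) * Complex.I)

/-- The parametrization `v(φ)` of the spectral variable. -/
noncomputable def v (M : ℕ) (φ : ℝ) : ℝ :=
  Real.sin ((M + 1) * φ) ^ (M + 1) / (Real.sin φ * Real.sin (M * φ) ^ M)

/-- The derivative of the phase function off the real axis. -/
lemma hasDerivAt_Fhat (M : ℕ) (a : ℝ) {z : ℂ} (hz : z.im ≠ 0) :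
    HasDerivAt (fun w => Fhat M w a)
      (((M : ℂ) + 1) * Complex.log z - Complex.log (z - 1) - (Real.log a : ℂ)) z := by
  have hz0 : z ≠ 0 := fun h => hz (by simp [h])
  have hz1 : z - 1 ≠ 0 := fun h => hz (by simpa using congrArg Complex.im h)
  have hlog := Complex.hasDerivAt_log (Complex.mem_slitPlane_iff.2 (Or.inr hz))
  have hsub : HasDerivAt (fun w : ℂ => w - 1) 1 z := (hasDerivAt_id z).sub_const 1
  have hlog1 := hsub.clog
    (Complex.mem_slitPlane_iff.2 (Or.inr (by simpa using hz)))
  have h := ((((hasDerivAt_id z).const_mul ((M : ℂ) + 1)).mul (hlog.sub_const 1)).sub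
    (hsub.mul (hlog1.sub_const 1))).sub ((hasDerivAt_id z).mul_const (Real.log a : ℂ))
  refine h.congr_deriv ?_
  simp only [id]
  field_simp
  ring

/-- The second derivative of the phase function off the real axis. -/
lemma hasDerivAt_deriv_Fhat (M : ℕ) (a : ℝ) {z : ℂ} (hz : z.im ≠ 0) :
    HasDerivAt
      (fun w => ((M : ℂ) + 1) * Complex.log w - Complex.log (w - 1) - (Real.log a : ℂ))
      (((M : ℂ) + 1) * z⁻¹ - (z - 1)⁻¹) z := by
  have hlog := Complex.hasDerivAt_log (Complex.mem_slitPlane_iff.2 (Or.inr hz))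
  have hlog1 := ((hasDerivAt_id z).sub_const 1).clog
    (Complex.mem_slitPlane_iff.2 (Or.inr (by simpa using hz)))
  exact (((hlog.const_mul ((M : ℂ) + 1)).sub hlog1).sub_const (Real.log a : ℂ)).congr_deriv
    (by simp)

/-- The chain rule along a vertical line. -/
lemma HasDerivAt.comp_vertical_line {f : ℂ → ℂ} {f' : ℂ} {x t : ℝ}
    (hf : HasDerivAt f f' ((x : ℂ) + (t : ℂ) * Complex.I)) :
    HasDerivAt (fun s : ℂ => f ((x : ℂ) + s * Complex.I)) (f' * Complex.I) (t : ℂ) :=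
  hf.comp (t : ℂ) ((((hasDerivAt_id (t : ℂ)).mul_const Complex.I).const_add (x : ℂ)).congr_deriv
    (one_mul _))

/-- The second `y`-derivative of `Re F̂(x + iy; a)`; in particular it is independent
of `a`. -/
theorem second_y_derivative_of_phase
    (M : ℕ) (hM : 1 ≤ M) (a : ℝ) (ha : 0 < a) (x : ℝ) (y : ℝ) (hy : y ≠ 0) :
    iteratedDeriv 2 (fun t : ℝ => (Fhat M ((x : ℂ) + (t : ℂ) * Complex.I) a).re) y =
      (((M : ℝ) + 1 - M * x) * x * (x - 1) - ((M : ℝ) * x + 1) * y ^ 2) /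
        ((x ^ 2 + y ^ 2) * ((x - 1) ^ 2 + y ^ 2)) := by
  have him : ∀ t : ℝ, t ≠ 0 → ((x : ℂ) + (t : ℂ) * Complex.I).im ≠ 0 := fun t ht => by
    simpa using ht
  have hfirst : deriv (fun t : ℝ => (Fhat M ((x : ℂ) + (t : ℂ) * Complex.I) a).re) =ᶠ[nhds y]
      fun t : ℝ => ((((M : ℂ) + 1) * Complex.log ((x : ℂ) + (t : ℂ) * Complex.I) -
        Complex.log ((x : ℂ) + (t : ℂ) * Complex.I - 1) - (Real.log a : ℂ)) * Complex.I).re := by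
    filter_upwards [isOpen_ne.mem_nhds hy] with t ht
    exact (hasDerivAt_Fhat M a (him t ht)).comp_vertical_line.real_of_complex.deriv
  have hsecond := ((hasDerivAt_deriv_Fhat M a (him y hy)).comp_vertical_line.mul_const
    Complex.I).real_of_complex
  rw [iteratedDeriv_succ, iteratedDeriv_one, hfirst.deriv_eq, hsecond.deriv]
  have h0 : x ^ 2 + y ^ 2 ≠ 0 := by positivity
  have h1 : (x - 1) ^ 2 + y ^ 2 ≠ 0 := by positivity
  have hre : ((((M : ℂ) + 1) * ((x : ℂ) + (y : ℂ) * Complex.I)⁻¹ -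
      ((x : ℂ) + (y : ℂ) * Complex.I - 1)⁻¹) * Complex.I * Complex.I).re =
      -(((M : ℝ) + 1) * (x / (x ^ 2 + y ^ 2)) - (x - 1) / ((x - 1) ^ 2 + y ^ 2)) := by
    rw [mul_assoc, Complex.I_mul_I]
    simp [Complex.inv_re, Complex.normSq_apply, ← sq]
  rw [hre]
  field_simp
  ring
end

section
/- Algebraic identity for the steepest ascent curve: Fix an integer M ≥ 1. For every φ ∈ (0, π/(M+1)): (i) ζ(φ)^{M+1} = v(φ)·(ζ(φ) − 1); (ii) with principal branches, (M+1)·Log ζ(φ) − Log(ζ(φ) − 1) = log v(φ) exactly (the left-hand side is the real number log v(φ), with no 2πi correction). -/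
open Complex Real Set Filter

/-- The principal logarithm of a complex number in polar form. -/
theorem log_ofReal_mul_exp_mul_I {r θ : ℝ} (hr : 0 < r) (h₁ : -Real.pi < θ)
    (h₂ : θ ≤ Real.pi) :
    Complex.log ((r : ℂ) * Complex.exp ((θ : ℂ) * Complex.I)) =
      (Real.log r : ℂ) + (θ : ℂ) * Complex.I := by
  rw [Complex.log_ofReal_mul hr (Complex.exp_ne_zero _),
    Complex.log_exp (by simpa using h₁) (by simpa using h₂)]

/-- The polar form of `ζ(φ) - 1`. -/
theorem zeta_sub_one (M : ℕ) (φ : ℝ) (h : Real.sin (M * φ) ≠ 0) :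
    zeta M φ - 1 = ((Real.sin φ / Real.sin (M * φ) : ℝ) : ℂ) *
      Complex.exp (((((M : ℝ) + 1) * φ : ℝ) : ℂ) * Complex.I) := by
  have h' : Complex.sin ((M : ℂ) * φ) ≠ 0 := by exact_mod_cast h
  rw [zeta, Complex.exp_mul_I, Complex.exp_mul_I]
  push_cast
  field_simp
  rw [add_mul, one_mul, Complex.sin_add, Complex.cos_add]
  linear_combination Complex.sin ((M : ℂ) * φ) * Complex.sin_sq_add_cos_sq (φ : ℂ)

/-- Algebraic identity for the steepest ascent curve: `ζ(φ)^{M+1} = v(φ)(ζ(φ) - 1)` and,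
with principal branches, `(M+1) Log ζ(φ) - Log(ζ(φ) - 1) = log v(φ)` exactly. -/
theorem algebraic_identity_ascent_curve
    (M : ℕ) (hM : 1 ≤ M)
    (φ : ℝ) (hφ : φ ∈ Set.Ioo (0 : ℝ) (Real.pi / ((M : ℝ) + 1))) :
    zeta M φ ^ (M + 1) = ((v M φ : ℝ) : ℂ) * (zeta M φ - 1) ∧
    ((M : ℂ) + 1) * Complex.log (zeta M φ) - Complex.log (zeta M φ - 1) =
      ((Real.log (v M φ) : ℝ) : ℂ) := by
  obtain ⟨h0, h1⟩ := hφ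
  have hM' : (1 : ℝ) ≤ M := by exact_mod_cast hM
  have h2 : ((M : ℝ) + 1) * φ < Real.pi := by
    rw [lt_div_iff₀ (by positivity)] at h1
    linarith
  have hMφ : 0 < (M : ℝ) * φ := by positivity
  have hS : 0 < Real.sin (((M : ℝ) + 1) * φ) :=
    Real.sin_pos_of_pos_of_lt_pi (by positivity) h2
  have hT : 0 < Real.sin ((M : ℝ) * φ) :=
    Real.sin_pos_of_pos_of_lt_pi hMφ (by linarith)
  have hs : 0 < Real.sin φ := Real.sin_pos_of_pos_of_lt_pi h0 (by nlinarith)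
  have hsub := zeta_sub_one M φ hT.ne'
  constructor
  · rw [hsub, zeta, v, mul_pow, ← Complex.exp_nat_mul, ← mul_assoc (Complex.ofReal _),
      ← Complex.ofReal_pow, ← Complex.ofReal_mul]
    congr 2
    · rw [div_pow, pow_succ (Real.sin ((M : ℝ) * φ))]
      field_simp
    · push_cast
      ring
  · rw [hsub, zeta, log_ofReal_mul_exp_mul_I (div_pos hS hT) (by linarith) (by nlinarith),
      log_ofReal_mul_exp_mul_I (div_pos hs hT) (by linarith) h2.le, v,
      Real.log_div (pow_pos hS _).ne' (mul_pos hs (pow_pos hT _)).ne',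
      Real.log_mul hs.ne' (pow_pos hT _).ne',
      Real.log_pow, Real.log_pow, Real.log_div hS.ne' hT.ne', Real.log_div hs.ne' hT.ne']
    push_cast
    ring
end
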